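/- Let J be a TAP instance in which every applicant's preference order is the restriction of a common master list s₁, s₂, …, s_m of the schools. Then the matching M produced by the Dual Serial Dictatorship algorithm — starting from M = ∅, processing the schools in master-list order, and for each school s_j processing the applicants on s_j's preference list in order, adding the pair (a, s_j) to M whenever a is still unassigned and currently |M_p(s_j)| < c_p(s_j) for both subjects p ∈ p(a) — is a stable matching of J. -/

import Mathlib

structure TAP (A : Type*) (S : Type*) (P : Type*) where
  ptype : A → Finset P
  prefA : A → List S
  cap : S → P → ℕ
  prefS : S → List A

namespace TAP

variable {A S P : Type*} [DecidableEq A] [DecidableEq S] [DecidableEq P] (J : TAP A S P)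

def WellFormed : Prop :=
  (∀ a, (J.ptype a).card = 2) ∧ (∀ a, (J.prefA a).Nodup) ∧
  (∀ s, (J.prefS s).Nodup) ∧ (∀ a s, a ∈ J.prefS s ↔ s ∈ J.prefA a)

def IsAssignment (M : Finset (A × S)) : Prop :=
  (∀ x ∈ M, x.2 ∈ J.prefA x.1) ∧
  ∀ a s s', (a, s) ∈ M → (a, s') ∈ M → s = s'

def Mp (M : Finset (A × S)) (s : S) (p : P) : Finset A :=
  (M.filter (fun x => x.2 = s ∧ p ∈ J.ptype x.1)).image Prod.fst

def Mpr (M : Finset (A × S)) (s : S) (p r : P) : Finset A :=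
  (M.filter (fun x => x.2 = s ∧ J.ptype x.1 = {p, r})).image Prod.fst

def IsMatching (M : Finset (A × S)) : Prop :=
  J.IsAssignment M ∧ ∀ s p, (J.Mp M s p).card ≤ J.cap s p

def Undersub (M : Finset (A × S)) (s : S) (p : P) : Prop :=
  (J.Mp M s p).card < J.cap s p

def PrefersA (a : A) (s s' : S) : Prop :=
  s ∈ J.prefA a ∧ s' ∈ J.prefA a ∧ (J.prefA a).idxOf s < (J.prefA a).idxOf s'

def PrefersS (s : S) (a a' : A) : Prop :=
  a ∈ J.prefS s ∧ a' ∈ J.prefS s ∧ (J.prefS s).idxOf a < (J.prefS s).idxOf a'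

def Unassigned (M : Finset (A × S)) (a : A) : Prop := ∀ s, (a, s) ∉ M

def Blocks (M : Finset (A × S)) (a : A) (s : S) : Prop :=
  s ∈ J.prefA a ∧
  (Unassigned M a ∨ ∃ s', (a, s') ∈ M ∧ J.PrefersA a s s') ∧
  ∃ p₁ p₂, p₁ ≠ p₂ ∧ J.ptype a = {p₁, p₂} ∧
    ((J.Undersub M s p₁ ∧ J.Undersub M s p₂) ∨
     (J.Undersub M s p₁ ∧ ∃ b ∈ J.Mp M s p₂, J.PrefersS s a b) ∨
     (J.Undersub M s p₂ ∧ ∃ b ∈ J.Mp M s p₁, J.PrefersS s a b) ∨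
     (∃ b ∈ J.Mpr M s p₁ p₂, J.PrefersS s a b) ∨
     (∃ b₁ ∈ J.Mp M s p₁, ∃ b₂ ∈ J.Mp M s p₂, b₁ ≠ b₂ ∧ J.PrefersS s a b₁ ∧ J.PrefersS s a b₂))

def Stable (M : Finset (A × S)) : Prop :=
  J.IsMatching M ∧ ∀ a s, ¬ J.Blocks M a s

end TAP
namespace TAP

variable {A S P : Type*} [DecidableEq A] [DecidableEq S] [DecidableEq P] (J : TAP A S P)

/-- School `s` has enough free capacity in matching `M` to accept applicant `a`. -/
def Enough (M : Finset (A × S)) (a : A) (s : S) : Prop :=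
  ∀ p ∈ J.ptype a, (J.Mp M s p).card < J.cap s p

instance (M : Finset (A × S)) (a : A) (s : S) : Decidable (J.Enough M a s) := by
  unfold Enough; infer_instance

/-- One step of dual serial dictatorship: school `s` goes through its preference list
in order and takes each applicant who is still unassigned and for whom it still
has enough free capacity. -/
def dualStep (M : Finset (A × S)) (s : S) : Finset (A × S) :=
  (J.prefS s).foldl
    (fun M a => if a ∉ M.image Prod.fst ∧ J.Enough M a s then insert (a, s) M else M) M

/-- Dual serial dictatorship: process the schools in master-list order. -/
def dualSerialDict (mls : List S) : Finset (A × S) := mls.foldl J.dualStep ∅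

end TAP

namespace TAP

section Offers

variable {A S P : Type*} (J : TAP A S P)

/-- The pairs in the order in which dual serial dictatorship considers them. -/
def offers (l : List S) : List (A × S) :=
  l.flatMap fun s => (J.prefS s).map fun a => (a, s)

theorem mem_offers {l : List S} {a : A} {s : S} :
    (a, s) ∈ J.offers l ↔ s ∈ l ∧ a ∈ J.prefS s := by
  simp [offers]

end Offers

variable {A S P : Type*} [DecidableEq A] [DecidableEq S] [DecidableEq P] (J : TAP A S P)

/-- Offer the pair `x` to the assignment `M`, adding it if its applicant is free and fits. -/
def offer (M : Finset (A × S)) (x : A × S) : Finset (A × S) :=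
  if x.1 ∉ M.image Prod.fst ∧ J.Enough M x.1 x.2 then insert x M else M

theorem dualSerialDict_eq (l : List S) :
    J.dualSerialDict l = (J.offers l).foldl J.offer ∅ := by
  unfold dualSerialDict offers dualStep offer
  rw [List.foldl_flatMap]
  simp only [List.foldl_map]

theorem mem_Mp {M : Finset (A × S)} {s : S} {p : P} {a : A} :
    a ∈ J.Mp M s p ↔ (a, s) ∈ M ∧ p ∈ J.ptype a := by
  simp [Mp]

theorem Mp_mono {M N : Finset (A × S)} (h : M ⊆ N) (s : S) (p : P) :
    J.Mp M s p ⊆ J.Mp N s p := by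
  intro a ha
  rw [mem_Mp] at ha ⊢
  exact ⟨h ha.1, ha.2⟩

theorem subset_offer (M : Finset (A × S)) (x : A × S) : M ⊆ J.offer M x := by
  unfold offer
  split_ifs
  · exact Finset.subset_insert _ _
  · rfl

theorem subset_foldl_offer (l : List (A × S)) (M : Finset (A × S)) :
    M ⊆ l.foldl J.offer M := by
  induction l generalizing M with
  | nil => rfl
  | cons x l ih => exact (J.subset_offer M x).trans (ih _)

theorem mem_of_mem_foldl_offer {l : List (A × S)} {M : Finset (A × S)} {x : A × S}
    (h : x ∈ l.foldl J.offer M) : x ∈ M ∨ x ∈ l := by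
  induction l generalizing M with
  | nil => exact Or.inl h
  | cons y l ih =>
    rcases ih h with h | h
    · unfold offer at h
      split_ifs at h <;> grind
    · grind

theorem isMatching_offer {M : Finset (A × S)} (h : J.IsMatching M) {x : A × S}
    (hx : x.2 ∈ J.prefA x.1) : J.IsMatching (J.offer M x) := by
  unfold offer
  split_ifs with hc
  · obtain ⟨hfree, hroom⟩ := hc
    obtain ⟨a, t⟩ := x
    have hfree' : ∀ s, (a, s) ∉ M := by simpa using hfree
    refine ⟨⟨?_, ?_⟩, ?_⟩
    · have := h.1.1
      grind
    · have := h.1.2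
      grind
    · intro s p
      by_cases hs : s = t ∧ p ∈ J.ptype a
      · obtain ⟨rfl, hp⟩ := hs
        have hsub : J.Mp (insert (a, s) M) s p ⊆ insert a (J.Mp M s p) := by
          intro b hb
          simp only [mem_Mp, Finset.mem_insert, Prod.mk.injEq] at hb ⊢
          tauto
        exact (Finset.card_le_card hsub).trans
          ((Finset.card_insert_le _ _).trans (hroom p hp))
      · have hsub : J.Mp (insert (a, t) M) s p ⊆ J.Mp M s p := by
          intro b hb
          simp only [mem_Mp, Finset.mem_insert, Prod.mk.injEq] at hb ⊢
          grind
        exact (Finset.card_le_card hsub).trans (h.2 s p)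
  · exact h

theorem isMatching_foldl_offer {l : List (A × S)} {M : Finset (A × S)} (h : J.IsMatching M)
    (hl : ∀ x ∈ l, x.2 ∈ J.prefA x.1) : J.IsMatching (l.foldl J.offer M) := by
  induction l generalizing M with
  | nil => exact h
  | cons x l ih =>
    exact ih (J.isMatching_offer h (hl x (by simp))) fun y hy => hl y (by simp [hy])

theorem isMatching_empty : J.IsMatching ∅ := by
  simp [IsMatching, IsAssignment, Mp]

/-- A pair is accepted when it is offered, unless its applicant is already assigned or the
school is full, with earlier pairs only, in one of the applicant's subjects. -/
theorem mem_or_assigned_or_full {l₁ l₂ : List (A × S)} {a : A} {s : S}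
    (hM : J.IsMatching ((l₁ ++ (a, s) :: l₂).foldl J.offer ∅)) :
    (a, s) ∈ (l₁ ++ (a, s) :: l₂).foldl J.offer ∅ ∨
    (∃ t, (a, t) ∈ (l₁ ++ (a, s) :: l₂).foldl J.offer ∅ ∧ (a, t) ∈ l₁) ∨
    ∃ p ∈ J.ptype a, ¬ J.Undersub ((l₁ ++ (a, s) :: l₂).foldl J.offer ∅) s p ∧
      ∀ b ∈ J.Mp ((l₁ ++ (a, s) :: l₂).foldl J.offer ∅) s p, (b, s) ∈ l₁ := by
  have hsub : J.offer (l₁.foldl J.offer ∅) (a, s) ⊆ (l₁ ++ (a, s) :: l₂).foldl J.offer ∅ := by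
    rw [List.foldl_append]
    exact J.subset_foldl_offer l₂ _
  set M := (l₁ ++ (a, s) :: l₂).foldl J.offer ∅
  have hN : ∀ x ∈ l₁.foldl J.offer ∅, x ∈ l₁ := fun x hx => by
    simpa using J.mem_of_mem_foldl_offer hx
  have hNM := (J.subset_offer (l₁.foldl J.offer ∅) (a, s)).trans hsub
  by_cases hfree : a ∈ (l₁.foldl J.offer ∅).image Prod.fst
  · obtain ⟨t, ht⟩ : ∃ t, (a, t) ∈ l₁.foldl J.offer ∅ := by simpa using hfree
    exact Or.inr (Or.inl ⟨t, hNM ht, hN _ ht⟩)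
  by_cases hroom : J.Enough (l₁.foldl J.offer ∅) a s
  · refine Or.inl (hsub ?_)
    simp only [offer]
    rw [if_pos ⟨hfree, hroom⟩]
    exact Finset.mem_insert_self _ _
  · simp only [Enough, not_forall, not_lt] at hroom
    obtain ⟨p, hp, hcap⟩ := hroom
    have heq := Finset.eq_of_subset_of_card_le (J.Mp_mono hNM s p) ((hM.2 s p).trans hcap)
    refine Or.inr (Or.inr ⟨p, hp, ?_, fun b hb => ?_⟩)
    · rw [Undersub, ← heq]
      exact not_lt.mpr hcap
    · rw [← heq, mem_Mp] at hb
      exact hN _ hb.1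

theorem not_blocks_of_full {M : Finset (A × S)} {a : A} {s : S} {p : P}
    (hp : p ∈ J.ptype a) (hfull : ¬ J.Undersub M s p)
    (hbest : ∀ b ∈ J.Mp M s p, ¬ J.PrefersS s a b) : ¬ J.Blocks M a s := by
  rintro ⟨-, -, p₁, p₂, -, htype, h⟩
  have hpr : ∀ b ∈ J.Mpr M s p₁ p₂, b ∈ J.Mp M s p := by
    intro b hb
    simp only [Mpr, Finset.mem_image, Finset.mem_filter] at hb
    obtain ⟨⟨b', s'⟩, ⟨hbM, rfl, hbt⟩, rfl⟩ := hb
    exact J.mem_Mp.mpr ⟨hbM, by rw [hbt, ← htype]; exact hp⟩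
  have hcases : p = p₁ ∨ p = p₂ := by simpa [htype] using hp
  rcases hcases with rfl | rfl <;> grind

end TAP

theorem List.idxOf_lt_idxOf_of_mem_left {α : Type*} [DecidableEq α] {l₁ l₂ : List α} {x y : α}
    (hx : x ∈ l₁) (hy : y ∉ l₁) : (l₁ ++ y :: l₂).idxOf x < (l₁ ++ y :: l₂).idxOf y := by
  rw [List.idxOf_append_of_mem hx, List.idxOf_append_of_notMem hy]
  exact (List.idxOf_lt_length_of_mem hx).trans_le (Nat.le_add_right _ _)

theorem stmt4 {A S P : Type*} [DecidableEq A] [DecidableEq S] [DecidableEq P]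
    (J : TAP A S P) (hwf : J.WellFormed) (mls : List S) (hnd : mls.Nodup)
    (hall : ∀ s : S, s ∈ mls)
    (hmaster : ∀ a : A, J.prefA a = mls.filter (fun s => decide (s ∈ J.prefA a))) :
    J.Stable (J.dualSerialDict mls) := by
  obtain ⟨-, -, hndS, hacc⟩ := hwf
  rw [J.dualSerialDict_eq]
  have hM : J.IsMatching ((J.offers mls).foldl J.offer ∅) := by
    refine J.isMatching_foldl_offer J.isMatching_empty ?_
    rintro ⟨a, s⟩ h
    exact (hacc a s).mp (J.mem_offers.mp h).2
  refine ⟨hM, fun a s hblock => ?_⟩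
  obtain ⟨l₁, l₂, rfl⟩ := List.append_of_mem (hall s)
  obtain ⟨q₁, q₂, hq⟩ := List.append_of_mem ((hacc a s).mpr hblock.1)
  have hs : s ∉ l₁ := by grind
  have ha : a ∉ q₁ := by
    have := hndS s
    grind
  have hsplit : J.offers (l₁ ++ s :: l₂) =
      (J.offers l₁ ++ q₁.map fun b => (b, s)) ++
        (a, s) :: ((q₂.map fun b => (b, s)) ++ J.offers l₂) := by
    simp [TAP.offers, hq]
  have hfilter := hmaster a
  rw [List.filter_append, List.filter_cons_of_pos (by simpa using hblock.1)] at hfilter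
  have hnot : ∀ t ∈ l₁, ¬ J.PrefersA a s t := by
    rintro t ht ⟨-, hta, hlt⟩
    rw [hfilter] at hlt
    exact hlt.not_gt (List.idxOf_lt_idxOf_of_mem_left (by simpa [ht] using hta) (by simp [hs]))
  have hearly : ∀ t, (a, t) ∈ (J.offers (l₁ ++ s :: l₂)).foldl J.offer ∅ →
      ¬ (t = s ∨ t ∈ l₁) := by
    intro t htM ht
    rcases hblock.2.1 with hun | ⟨t', ht'M, hpref⟩
    · exact hun t htM
    · obtain rfl := hM.1.2 a t t' htM ht'M
      rcases ht with rfl | ht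
      · exact lt_irrefl _ hpref.2.2
      · exact hnot t ht hpref
  have hcases := hM
  rw [hsplit] at hcases
  replace hcases := J.mem_or_assigned_or_full hcases
  rw [← hsplit] at hcases
  rcases hcases with h | ⟨t, htM, ht⟩ | ⟨p, hp, hfull, hbest⟩
  · exact hearly s h (Or.inl rfl)
  · rcases List.mem_append.mp ht with ht | ht
    · exact hearly t htM (Or.inr (J.mem_offers.mp ht).1)
    · simp [ha] at ht
  · refine J.not_blocks_of_full hp hfull (fun b hb hpref => ?_) hblock
    have hbq : b ∈ q₁ := by simpa [J.mem_offers, hs] using hbest b hb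
    have hlt := hpref.2.2
    rw [hq] at hlt
    exact hlt.not_gt (List.idxOf_lt_idxOf_of_mem_left hbq ha)
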